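/- Let F : ℝⁿ → ℝᵐ have components F₁,…,F_m, let λ̄ ∈ Λᵐ, x̄ ∈ ℝⁿ, and let ω > 0, a > 0, b > 0 with ω a²/(2b) < 1. Suppose sequences (xᵏ) in ℝⁿ and (vᵏ) in ℝⁿ satisfy, for every k: Fᵢ(xᵏ⁺¹) ≤ Fᵢ(xᵏ) − ω‖vᵏ‖² for every i ∈ {1,…,m}, and Σᵢ λ̄ᵢ (Fᵢ(xᵏ) − Fᵢ(x̄)) ≤ (2b/a²)‖vᵏ‖². Then for every k, Σᵢ λ̄ᵢ (Fᵢ(xᵏ) − Fᵢ(x̄)) ≤ (1 − ω a²/(2b))ᵏ · Σᵢ λ̄ᵢ (Fᵢ(x⁰) − Fᵢ(x̄)). -/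

import Mathlib

theorem merit_function_linear_decrease
    (n m : ℕ) (hm : 0 < m)
    (F : Fin m → EuclideanSpace ℝ (Fin n) → ℝ)
    (lamb : Fin m → ℝ) (hlamb : lamb ∈ stdSimplex ℝ (Fin m))
    (xbar : EuclideanSpace ℝ (Fin n))
    (ω a b : ℝ) (hω : 0 < ω) (ha : 0 < a) (hb : 0 < b)
    (hlt : ω * a^2 / (2 * b) < 1)
    (x : ℕ → EuclideanSpace ℝ (Fin n)) (v : ℕ → EuclideanSpace ℝ (Fin n))
    (hdec : ∀ k, ∀ i : Fin m, F i (x (k + 1)) ≤ F i (x k) - ω * ‖v k‖^2)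
    (hbound : ∀ k, ∑ i, lamb i * (F i (x k) - F i xbar) ≤ (2 * b / a^2) * ‖v k‖^2) :
    ∀ k : ℕ, ∑ i, lamb i * (F i (x k) - F i xbar)
      ≤ (1 - ω * a^2 / (2 * b))^k * ∑ i, lamb i * (F i (x 0) - F i xbar) := by
  intro k
  induction k with
  | zero => simp
  | succ k ih =>
    have decrease : ∑ i, lamb i * (F i (x (k + 1)) - F i xbar)
        ≤ ∑ i, lamb i * (F i (x k) - F i xbar) - ω * ‖v k‖ ^ 2 := by
      calc ∑ i, lamb i * (F i (x (k + 1)) - F i xbar)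
          ≤ ∑ i, (lamb i * (F i (x k) - F i xbar) - lamb i * (ω * ‖v k‖ ^ 2)) := by
            refine Finset.sum_le_sum fun i _ => ?_
            rw [← mul_sub]
            exact mul_le_mul_of_nonneg_left (by linarith [hdec k i]) (hlamb.1 i)
        _ = ∑ i, lamb i * (F i (x k) - F i xbar) - ω * ‖v k‖ ^ 2 := by
            rw [Finset.sum_sub_distrib, ← Finset.sum_mul, hlamb.2, one_mul]
    have error_bound : ω * a ^ 2 / (2 * b) * ∑ i, lamb i * (F i (x k) - F i xbar)
        ≤ ω * ‖v k‖ ^ 2 := by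
      calc ω * a ^ 2 / (2 * b) * ∑ i, lamb i * (F i (x k) - F i xbar)
          ≤ ω * a ^ 2 / (2 * b) * ((2 * b / a ^ 2) * ‖v k‖ ^ 2) :=
            mul_le_mul_of_nonneg_left (hbound k) (by positivity)
        _ = ω * ‖v k‖ ^ 2 := by field_simp
    calc ∑ i, lamb i * (F i (x (k + 1)) - F i xbar)
        ≤ (1 - ω * a ^ 2 / (2 * b)) * ∑ i, lamb i * (F i (x k) - F i xbar) := by
          linarith
      _ ≤ (1 - ω * a ^ 2 / (2 * b)) * ((1 - ω * a ^ 2 / (2 * b)) ^ k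
            * ∑ i, lamb i * (F i (x 0) - F i xbar)) :=
          mul_le_mul_of_nonneg_left ih (sub_nonneg.2 hlt.le)
      _ = (1 - ω * a ^ 2 / (2 * b)) ^ (k + 1)
            * ∑ i, lamb i * (F i (x 0) - F i xbar) := by
          rw [pow_succ' _ k, mul_assoc]
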